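/- Let f : ∀ (X : Type), (X → X) → (X → X) be natural under equivalence, and suppose that f Bool id is not pointwise equal to the identity function on Bool (i.e. there is b : Bool with f Bool id b ≠ b). Then the law of excluded middle holds. -/

import Mathlib

/-- An inhabited subsingleton with a point adjoined is equivalent to `Bool`, the adjoined point
corresponding to any prescribed `b : Bool`. -/
def optionEquivBoolOfSubsingleton {P : Type*} [Subsingleton P] (p : P) (b : Bool) :
    Option P ≃ Bool where
  toFun o := o.elim b fun _ => !b
  invFun c := if c = b then none else some p
  left_inv
    | none => if_pos rfl
    | some q => by
      have h : (!b) ≠ b := by cases b <;> decide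
      exact (if_neg h).trans (congrArg some (Subsingleton.elim p q))
  right_inv c := by cases b <;> cases c <;> rfl

/-- If `f : ∀ X : Type, (X → X) → (X → X)` is natural under equivalence and
`f Bool id` is not pointwise equal to the identity, then the law of excluded
middle holds. -/
theorem stmt_10 (f : ∀ X : Type, (X → X) → (X → X))
    (hnat : ∀ (X Y : Type) (e : X ≃ Y) (g : X → X) (x : X),
      e (f X g x) = f Y (e ∘ g ∘ e.symm) (e x))
    (hne : ∃ b : Bool, f Bool id b ≠ b) :
    ∀ P : Type, Subsingleton P → Nonempty P ∨ IsEmpty P := by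
  intro P _
  obtain ⟨b, hb⟩ := hne
  match h : f (Option P) id none with
  | some p => exact Or.inl ⟨p⟩
  | none =>
    refine Or.inr ⟨fun p => hb ?_⟩
    let e := optionEquivBoolOfSubsingleton p b
    have he : e ∘ id ∘ e.symm = id := funext e.apply_symm_apply
    have key := hnat _ _ e id none
    rw [h, he] at key
    exact key.symm
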